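/- (Per-process-set loss equivalence, Equation 8.) For every process set λ ∈ B(G) and every integer t with s(λ) ≤ t < e(λ): ∑_{i∈λ} (P_{i,t}·A_{i,t} − D_{i,t}) = ∑_{i∈λ} (P_{i,t}·a_i − D_{i,t}), and both sides equal |λ|·(F(p)·Â(λ) − H(p)), where p = g_i.take(t+1) is the common prefix, which is the same for every i ∈ λ. -/

import Mathlib

/-- `nodeG g p` is the set of indices `i` such that `p` is a prefix of the trajectory `g i`. -/
noncomputable def nodeG {α : Type*} {k : ℕ} (g : Fin k → List α) (p : List α) :
    Finset (Fin k) :=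
  @Finset.filter _ (fun i => p <+: g i) (Classical.decPred _) Finset.univ

/-- `BG g` is the family of process sets: nonempty sets of the form `nodeG g p`. -/
def BG {α : Type*} {k : ℕ} (g : Fin k → List α) : Set (Finset (Fin k)) :=
  {L | ∃ p : List α, (nodeG g p).Nonempty ∧ nodeG g p = L}

/-- `eG g L` is the length of the longest common prefix of the trajectories `g i`, `i ∈ L`. -/
noncomputable def eG {α : Type*} {k : ℕ} (g : Fin k → List α) (L : Finset (Fin k)) : ℕ :=
  sSup {n : ℕ | ∃ p : List α, p.length = n ∧ ∀ i ∈ L, p <+: g i}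

-- The immediate parent of a process set: its least strict superset in `BG g`.
open Classical in
noncomputable def parentG {α : Type*} {k : ℕ} (g : Fin k → List α) (L : Finset (Fin k)) :
    Finset (Fin k) :=
  if h : ∃ M, M ∈ BG g ∧ L ⊂ M ∧ ∀ M' ∈ BG g, L ⊂ M' → M ⊆ M' then h.choose
  else Finset.univ

/-- Start index of the process step of `L`: `0` for the root, `eG g (parentG g L)` otherwise. -/
noncomputable def sG {α : Type*} {k : ℕ} (g : Fin k → List α) (L : Finset (Fin k)) : ℕ :=
  if L = Finset.univ then 0 else eG g (parentG g L)

/-- `XtG g t` is the family of process sets whose token span contains the index `t`. -/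
noncomputable def XtG {α : Type*} {k : ℕ} (g : Fin k → List α) (t : ℕ) :
    Finset (Finset (Fin k)) :=
  @Finset.filter _ (fun L => L ∈ BG g ∧ sG g L ≤ t ∧ t < eG g L)
    (Classical.decPred _) Finset.univ

/-- Mean of the rewards. -/
noncomputable def rmeanG {k : ℕ} (r : Fin k → ℝ) : ℝ := (∑ i, r i) / k

/-- Standard deviation of the rewards. -/
noncomputable def rstdG {k : ℕ} (r : Fin k → ℝ) : ℝ :=
  Real.sqrt ((∑ i, (r i - rmeanG r) ^ 2) / k)

/-- Outcome-level advantage `a_i`. -/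
noncomputable def advG {k : ℕ} (r : Fin k → ℝ) (i : Fin k) : ℝ :=
  (r i - rmeanG r) / rstdG r

/-- Step-level reward `R̂(λ)`. -/
noncomputable def RhatG {k : ℕ} (r : Fin k → ℝ) (L : Finset (Fin k)) : ℝ :=
  (∑ i ∈ L, r i) / L.card

/-- Step-level advantage `Â(λ)`. -/
noncomputable def AhatG {k : ℕ} (r : Fin k → ℝ) (L : Finset (Fin k)) : ℝ :=
  (RhatG r L - rmeanG r) / rstdG r

section ProcessSets

variable {α : Type*} {k : ℕ} {g : Fin k → List α} {L M : Finset (Fin k)} {p q : List α}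

theorem mem_nodeG {i : Fin k} : i ∈ nodeG g p ↔ p <+: g i := by
  simp [nodeG]

theorem nodeG_anti (h : p <+: q) : nodeG g q ⊆ nodeG g p := fun _ hi =>
  mem_nodeG.2 (h.trans (mem_nodeG.1 hi))

/-- Process sets that share a trajectory are nested. -/
theorem BG_subset_total {i : Fin k} (hL : L ∈ BG g) (hM : M ∈ BG g) (hiL : i ∈ L) (hiM : i ∈ M) :
    L ⊆ M ∨ M ⊆ L := by
  obtain ⟨p, -, rfl⟩ := hL
  obtain ⟨q, -, rfl⟩ := hM
  exact (List.prefix_or_prefix_of_prefix (mem_nodeG.1 hiL) (mem_nodeG.1 hiM)).symm.imp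
    nodeG_anti nodeG_anti

/-- A nonempty set of indices with a strict superset in `BG g` has a least one. -/
theorem exists_least_ssuperset_BG (hL : L.Nonempty) (hM : M ∈ BG g) (hLM : L ⊂ M) :
    ∃ N, N ∈ BG g ∧ L ⊂ N ∧ ∀ N' ∈ BG g, L ⊂ N' → N ⊆ N' := by
  obtain ⟨i, hi⟩ := hL
  obtain ⟨N, hN⟩ := (Set.toFinite {N | N ∈ BG g ∧ L ⊂ N}).exists_minimal ⟨M, hM, hLM⟩
  refine ⟨N, hN.prop.1, hN.prop.2, fun N' hN' hLN' => ?_⟩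
  exact (BG_subset_total hN.prop.1 hN' (hN.prop.2.1 hi) (hLN'.1 hi)).elim id
    fun h => hN.le_of_le ⟨hN', hLN'⟩ h

theorem ssubset_parentG (hL : L.Nonempty) (hM : M ∈ BG g) (hLM : L ⊂ M) :
    L ⊂ parentG g L := by
  have h := exists_least_ssuperset_BG hL hM hLM
  rw [parentG, dif_pos h]
  exact h.choose_spec.2.1

theorem parentG_subset (hL : L.Nonempty) (hM : M ∈ BG g) (hLM : L ⊂ M) :
    parentG g L ⊆ M := by
  have h := exists_least_ssuperset_BG hL hM hLM
  rw [parentG, dif_pos h]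
  exact h.choose_spec.2.2 M hM hLM

theorem bddAbove_length_commonPrefix (hL : L.Nonempty) :
    BddAbove {n : ℕ | ∃ p : List α, p.length = n ∧ ∀ i ∈ L, p <+: g i} := by
  obtain ⟨i, hi⟩ := hL
  refine ⟨(g i).length, ?_⟩
  rintro _ ⟨p, rfl, hp⟩
  exact (hp i hi).length_le

theorem length_le_eG (hL : L.Nonempty) (hp : ∀ i ∈ L, p <+: g i) : p.length ≤ eG g L :=
  le_csSup (bddAbove_length_commonPrefix hL) ⟨p, rfl, hp⟩

theorem exists_prefix_length_eq_eG (hL : L.Nonempty) :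
    ∃ p : List α, p.length = eG g L ∧ ∀ i ∈ L, p <+: g i :=
  Nat.sSup_mem (s := {n : ℕ | ∃ p : List α, p.length = n ∧ ∀ i ∈ L, p <+: g i})
    ⟨0, [], rfl, fun _ _ => List.nil_prefix⟩ (bddAbove_length_commonPrefix hL)

/-- Trajectories of `L` agree on their first `n` tokens when `n ≤ eG g L`. -/
theorem exists_take_eq_of_le_eG {n : ℕ} (hL : L.Nonempty) (hn : n ≤ eG g L) :
    ∃ p : List α, p.length = n ∧ ∀ i ∈ L, (g i).take n = p := by
  obtain ⟨q, hq, hqL⟩ := exists_prefix_length_eq_eG (g := g) hL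
  refine ⟨q.take n, by simp [hq, hn], fun i hi => ?_⟩
  obtain ⟨s, hs⟩ := hqL i hi
  rw [← hs, List.take_append_of_le_length (hq ▸ hn)]

/-- The node of the common prefix of length `n` is `L` itself when `sG g L < n`. -/
theorem nodeG_eq_of_sG_lt_length (hL : L.Nonempty) (hp : ∀ i ∈ L, p <+: g i)
    (hs : sG g L < p.length) : nodeG g p = L := by
  have hsub : L ⊆ nodeG g p := fun i hi => mem_nodeG.2 (hp i hi)
  by_contra hne
  have hss : L ⊂ nodeG g p := hsub.ssubset_of_ne (Ne.symm hne)
  have hmem : nodeG g p ∈ BG g := ⟨p, hL.mono hsub, rfl⟩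
  have huniv : L ≠ Finset.univ := by
    rintro rfl
    exact hss.2 (Finset.subset_univ _)
  have hle : p.length ≤ eG g (parentG g L) :=
    length_le_eG (hL.mono (ssubset_parentG hL hmem hss).1)
      fun i hi => mem_nodeG.1 (parentG_subset hL hmem hss hi)
  rw [sG, if_neg huniv] at hs
  omega

theorem sum_advG (r : Fin k → ℝ) (hL : L.Nonempty) :
    ∑ i ∈ L, advG r i = L.card * AhatG r L := by
  have hc : (L.card : ℝ) ≠ 0 := Nat.cast_ne_zero.2 hL.card_ne_zero
  simp only [advG, AhatG, RhatG, ← Finset.sum_div, Finset.sum_sub_distrib, Finset.sum_const,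
    nsmul_eq_mul]
  field_simp

end ProcessSets

/-- **Per-process-set loss equivalence (Equation 8).** For every process set `λ ∈ B(G)` and
`s(λ) ≤ t < e(λ)`, the PRM and GRPO loss contributions of `λ` at token `t` agree, and both
equal `|λ| · (F(p)·Â(λ) − H(p))` where `p = gᵢ.take (t+1)` is the common prefix
(the same for every `i ∈ λ`). -/
theorem per_process_set_loss_equivalence {α : Type*} {k : ℕ} (hk : 1 ≤ k)
    (g : Fin k → List α) (r : Fin k → ℝ) (hstd : 0 < rstdG r)
    (F H : List α → ℝ) (L : Finset (Fin k)) (hL : L ∈ BG g)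
    (t : ℕ) (hs : sG g L ≤ t) (he : t < eG g L) :
    (∑ i ∈ L, (F ((g i).take (t + 1)) * AhatG r (nodeG g ((g i).take (t + 1))) -
          H ((g i).take (t + 1))) =
        ∑ i ∈ L, (F ((g i).take (t + 1)) * advG r i - H ((g i).take (t + 1)))) ∧
      ∀ i ∈ L,
        (∀ j ∈ L, (g j).take (t + 1) = (g i).take (t + 1)) ∧
        ∑ j ∈ L, (F ((g j).take (t + 1)) * advG r j - H ((g j).take (t + 1))) =
          (L.card : ℝ) * (F ((g i).take (t + 1)) * AhatG r L - H ((g i).take (t + 1))) := by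
  have hne : L.Nonempty := by
    obtain ⟨p, hp, rfl⟩ := hL
    exact hp
  obtain ⟨p, hlen, hp⟩ := exists_take_eq_of_le_eG hne (Nat.succ_le_of_lt he)
  have hnode : nodeG g p = L :=
    nodeG_eq_of_sG_lt_length hne (fun i hi => hp i hi ▸ List.take_prefix _ _) (by omega)
  have hgrpo : ∑ j ∈ L, (F ((g j).take (t + 1)) * advG r j - H ((g j).take (t + 1))) =
      (L.card : ℝ) * (F p * AhatG r L - H p) := by
    rw [Finset.sum_congr rfl fun j hj => by rw [hp j hj], Finset.sum_sub_distrib,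
      ← Finset.mul_sum, sum_advG r hne, Finset.sum_const, nsmul_eq_mul]
    ring
  refine ⟨?_, fun i hi => ⟨fun j hj => (hp j hj).trans (hp i hi).symm, by rw [hgrpo, hp i hi]⟩⟩
  rw [hgrpo, Finset.sum_congr rfl fun j hj => by rw [hp j hj, hnode], Finset.sum_const,
    nsmul_eq_mul]
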